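/- Assume σ satisfies hypothesis (H^σ_α) and b satisfies hypothesis (H^b_β), and that b and σ are smooth in the space variable with bounded spatial derivatives of every order. Then for any T > 0 and any integer j ≥ 0 there exist constants C̃_j, λ̃_j > 0 depending only on Θ = (T,α,β,κ₀,κ₁,d) (in particular not on the derivative bounds of b and σ) such that for all (s,t) ∈ 𝔻^T_0 and x,y ∈ ℝ^d: (a) p̃₁(s,x,t,y) ≥ C̃₀·𝐠_{λ̃₀^{-1}}(s,x,t,y); and (b) for every γ ∈ [0,1], |x − θ_{s,t}(y)|^γ · |∇_x^j p̃₁(s,x,t,y)| ≤ C̃_j·(t−s)^{(γ−j)/2}·𝐠_{λ̃_j}(s,x,t,y). -/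

import Mathlib

noncomputable section

open MeasureTheory Matrix Set

/-- The state space `ℝ^d`. -/
abbrev Vec (d : ℕ) := EuclideanSpace ℝ (Fin d)

/-- Hypothesis (H^b_β): `b` is measurable, bounded at the origin uniformly in time
and Hölder/Lipschitz in space uniformly in time. -/
def HolderDrift (d : ℕ) (b : ℝ → Vec d → Vec d) (κ₁ β : ℝ) : Prop :=
  Measurable (Function.uncurry b) ∧
  (∀ t : ℝ, 0 ≤ t → ‖b t 0‖ ≤ κ₁) ∧
  (∀ t : ℝ, 0 ≤ t → ∀ x y : Vec d, ‖b t x - b t y‖ ≤ κ₁ * max (‖x - y‖ ^ β) ‖x - y‖)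

/-- A smooth nonnegative mollifier supported in the closed unit ball with total mass one. -/
structure IsMollifier (d : ℕ) (ρ : Vec d → ℝ) : Prop where
  smooth : ContDiff ℝ (⊤ : ℕ∞) ρ
  nonneg : ∀ x, 0 ≤ ρ x
  support_subset : Function.support ρ ⊆ Metric.closedBall 0 1
  integral_eq_one : ∫ x, ρ x = 1

/-- The spatially mollified drift `b_ε(t,x) = ∫ b(t,y) ρ_ε(x-y) dy`. -/
def mollifiedDrift (d : ℕ) (ρ : Vec d → ℝ) (ε : ℝ) (b : ℝ → Vec d → Vec d)
    (t : ℝ) (x : Vec d) : Vec d :=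
  ∫ y : Vec d, (ε ^ (-(d : ℝ)) * ρ (ε⁻¹ • (x - y))) • b t y

/-- `θ` is the flow of the (time-dependent) vector field `f`:
`θ t s x = x + ∫_s^t f(r, θ r s x) dr` for all nonnegative times. -/
def IsFlow (d : ℕ) (f : ℝ → Vec d → Vec d) (θ : ℝ → ℝ → Vec d → Vec d) : Prop :=
  ∀ s t : ℝ, 0 ≤ s → 0 ≤ t → ∀ x : Vec d,
    θ t s x = x + ∫ r in s..t, f r (θ r s x)

/-- The Gaussian kernel `g_λ(t,x) = t^{-d/2} exp(-λ |x|²/t)`. -/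
def gaussk (d : ℕ) (l t : ℝ) (x : Vec d) : ℝ :=
  t ^ (-(d : ℝ) / 2) * Real.exp (-l * ‖x‖ ^ 2 / t)

/-- A drift which is measurable, bounded at the origin uniformly in time, and Lipschitz in
space with constant `κ` uniformly in time. -/
def LipschitzDrift (d : ℕ) (b : ℝ → Vec d → Vec d) (κ : ℝ) : Prop :=
  Measurable (Function.uncurry b) ∧
  (∃ M : ℝ, ∀ t : ℝ, 0 ≤ t → ‖b t 0‖ ≤ M) ∧
  (∀ t : ℝ, 0 ≤ t → ∀ x y : Vec d, ‖b t x - b t y‖ ≤ κ * ‖x - y‖)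

/-- The diffusion matrix `σσ*`. -/
def sqMat (d : ℕ) (σ : ℝ → Vec d → Matrix (Fin d) (Fin d) ℝ) (t : ℝ) (x : Vec d) :
    Matrix (Fin d) (Fin d) ℝ :=
  σ t x * (σ t x)ᵀ

/-- Hypothesis (H^σ_α): measurability, uniform ellipticity with constant `κ₀`
and spatial α-Hölder continuity with constant `κ₀`. -/
def EllipticHolder (d : ℕ) (σ : ℝ → Vec d → Matrix (Fin d) (Fin d) ℝ) (κ₀ α : ℝ) : Prop :=
  (∀ i j : Fin d, Measurable fun p : ℝ × Vec d => σ p.1 p.2 i j) ∧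
  (∀ t : ℝ, 0 ≤ t → ∀ x : Vec d, ∀ ξ : Fin d → ℝ,
    κ₀⁻¹ * (ξ ⬝ᵥ ξ) ≤ (sqMat d σ t x).mulVec ξ ⬝ᵥ ξ ∧
      (sqMat d σ t x).mulVec ξ ⬝ᵥ ξ ≤ κ₀ * (ξ ⬝ᵥ ξ)) ∧
  (∀ t : ℝ, 0 ≤ t → ∀ x y : Vec d, ∀ i j : Fin d,
    |σ t x i j - σ t y i j| ≤ κ₀ * ‖x - y‖ ^ α)

/-- `b` is smooth in the space variable, with spatial derivatives of every order
bounded uniformly in time and space. -/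
def SmoothVecBounded (d : ℕ) (b : ℝ → Vec d → Vec d) : Prop :=
  (∀ t : ℝ, ContDiff ℝ (⊤ : ℕ∞) (b t)) ∧
  ∀ n : ℕ, 1 ≤ n → ∃ M : ℝ, ∀ t : ℝ, 0 ≤ t → ∀ x : Vec d,
    ‖iteratedFDeriv ℝ n (b t) x‖ ≤ M

/-- `σ` is smooth in the space variable, with spatial derivatives of every order
bounded uniformly in time and space. -/
def SmoothMatBounded (d : ℕ) (σ : ℝ → Vec d → Matrix (Fin d) (Fin d) ℝ) : Prop :=
  (∀ t : ℝ, ∀ i j : Fin d, ContDiff ℝ (⊤ : ℕ∞) fun x => σ t x i j) ∧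
  ∀ n : ℕ, 1 ≤ n → ∃ M : ℝ, ∀ t : ℝ, 0 ≤ t → ∀ x : Vec d, ∀ i j : Fin d,
    ‖iteratedFDeriv ℝ n (fun z => σ t z i j) x‖ ≤ M

/-- The mean shift `ϑ^{(τ,ξ)}_{t,s} = ∫_s^t b(r, θ_{r,τ}(ξ)) dr` of the frozen process. -/
def freezeMean (d : ℕ) (b : ℝ → Vec d → Vec d) (θ : ℝ → ℝ → Vec d → Vec d)
    (τ : ℝ) (ξ : Vec d) (s t : ℝ) : Vec d :=
  ∫ r in s..t, b r (θ r τ ξ)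

/-- The covariance `𝒞^{(τ,ξ)}_{t,s} = ∫_s^t (σσ*)(r, θ_{r,τ}(ξ)) dr` of the frozen process. -/
def freezeCov (d : ℕ) (σ : ℝ → Vec d → Matrix (Fin d) (Fin d) ℝ)
    (θ : ℝ → ℝ → Vec d → Vec d) (τ : ℝ) (ξ : Vec d) (s t : ℝ) :
    Matrix (Fin d) (Fin d) ℝ :=
  Matrix.of fun i j => ∫ r in s..t, sqMat d σ r (θ r τ ξ) i j

/-- The frozen Gaussian density
`p̃^{(τ,ξ)}(s,x,t,y) = ((2π)^d det 𝒞)^{-1/2} exp(−½ ⟨𝒞⁻¹ m, m⟩)`, `m = ϑ + x − y`. -/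
def frozenDensity (d : ℕ) (b : ℝ → Vec d → Vec d)
    (σ : ℝ → Vec d → Matrix (Fin d) (Fin d) ℝ) (θ : ℝ → ℝ → Vec d → Vec d)
    (τ : ℝ) (ξ : Vec d) (s : ℝ) (x : Vec d) (t : ℝ) (y : Vec d) : ℝ :=
  (Real.sqrt ((2 * Real.pi) ^ d * (freezeCov d σ θ τ ξ s t).det))⁻¹ *
    Real.exp (-(1 / 2) *
      ((freezeCov d σ θ τ ξ s t)⁻¹.mulVec (fun i => (freezeMean d b θ τ ξ s t + x - y) i) ⬝ᵥ
        fun i => (freezeMean d b θ τ ξ s t + x - y) i))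

/-- Integral form of Grönwall's inequality. -/
lemma le_mul_exp_of_le_add_integral {v : ℝ → ℝ} {a b c K : ℝ} (hab : a ≤ b) (hK : 0 ≤ K)
    (hv : ContinuousOn v (Icc a b)) (h : ∀ r ∈ Icc a b, v r ≤ c + K * ∫ q in a..r, v q) :
    v b ≤ c * Real.exp (K * (b - a)) := by
  have hint : ∀ r ∈ Icc a b, IntervalIntegrable v volume a r := fun r hr =>
    (hv.mono (Icc_subset_Icc_right hr.2)).intervalIntegrable_of_Icc hr.1
  set W : ℝ → ℝ := fun r => (c + K * ∫ q in a..r, v q) * Real.exp (-(K * (r - a))) with hW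
  have hcont : ContinuousOn W (Icc a b) := by
    have h1 := intervalIntegral.continuousOn_primitive_interval' (hint b (right_mem_Icc.2 hab))
      (left_mem_uIcc (a := a) (b := b))
    rw [uIcc_of_le hab] at h1
    exact (continuousOn_const.add (continuousOn_const.mul h1)).mul (by fun_prop)
  have hderiv : ∀ r ∈ Ioo a b, HasDerivAt W
      (K * (v r - (c + K * ∫ q in a..r, v q)) * Real.exp (-(K * (r - a)))) r := by
    intro r hr
    have h1 : HasDerivAt (fun u => ∫ q in a..u, v q) (v r) r :=
      intervalIntegral.integral_hasDerivAt_right (hint r (Ioo_subset_Icc_self hr))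
        ((hv.mono Ioo_subset_Icc_self).stronglyMeasurableAtFilter isOpen_Ioo r hr)
        (hv.continuousAt (Icc_mem_nhds hr.1 hr.2))
    have h2 : HasDerivAt (fun u : ℝ => Real.exp (-(K * (u - a))))
        (Real.exp (-(K * (r - a))) * (-(K * 1))) r :=
      ((((hasDerivAt_id r).sub_const a).const_mul K).neg).exp
    refine (((h1.const_mul K).const_add c).mul h2).congr_deriv ?_
    ring
  have hanti : AntitoneOn W (Icc a b) := by
    refine antitoneOn_of_deriv_nonpos (convex_Icc a b) hcont ?_ ?_ <;> rw [interior_Icc]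
    · exact fun r hr => (hderiv r hr).differentiableAt.differentiableWithinAt
    · intro r hr
      rw [(hderiv r hr).deriv]
      have := h r (Ioo_subset_Icc_self hr)
      exact mul_nonpos_of_nonpos_of_nonneg
        (mul_nonpos_of_nonneg_of_nonpos hK (by linarith)) (Real.exp_pos _).le
  have h1 := hanti (left_mem_Icc.2 hab) (right_mem_Icc.2 hab) hab
  have h2 : W a = c := by simp [hW]
  rw [h2] at h1
  simp only [hW, Real.exp_neg] at h1
  rw [← div_eq_mul_inv, div_le_iff₀ (Real.exp_pos _)] at h1
  exact (h b (right_mem_Icc.2 hab)).trans h1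

section Flow

variable {E : Type*} [NormedAddCommGroup E] [NormedSpace ℝ E]

/-- Forward growth of a primitive whose derivative grows at most linearly. -/
lemma norm_add_le_exp_mul_of_eq_add_integral {u g : ℝ → E} {x : E} {a b c K : ℝ} (hab : a ≤ b)
    (hK : 0 ≤ K) (hg : IntervalIntegrable g volume a b)
    (hu : ∀ r ∈ Icc a b, u r = x + ∫ q in a..r, g q)
    (hgu : ∀ r ∈ Icc a b, ‖g r‖ ≤ K * (c + ‖u r‖)) :
    c + ‖u b‖ ≤ (c + ‖x‖) * Real.exp (K * (b - a)) := by
  have hcont : ContinuousOn u (Icc a b) := by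
    have h1 := intervalIntegral.continuousOn_primitive_interval' hg
      (left_mem_uIcc (a := a) (b := b))
    rw [uIcc_of_le hab] at h1
    exact (continuousOn_const.add h1).congr hu
  have hv : ContinuousOn (fun r => c + ‖u r‖) (Icc a b) := continuousOn_const.add hcont.norm
  refine le_mul_exp_of_le_add_integral (v := fun r => c + ‖u r‖) hab hK hv fun r hr => ?_
  have h1 : ‖∫ q in a..r, g q‖ ≤ K * ∫ q in a..r, (c + ‖u q‖) := by
    rw [← intervalIntegral.integral_const_mul]
    refine intervalIntegral.norm_integral_le_of_norm_le hr.1 (.of_forall fun q hq => ?_) ?_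
    · exact hgu q ⟨hq.1.le, hq.2.trans hr.2⟩
    · exact ((hv.mono (Icc_subset_Icc_right hr.2)).intervalIntegrable_of_Icc hr.1).const_mul K
  have h2 : ‖u r‖ ≤ ‖x‖ + ‖∫ q in a..r, g q‖ := by
    rw [hu r hr]; exact norm_add_le _ _
  linarith

/-- Two-sided comparison of the endpoint values of a primitive whose derivative grows at most
linearly. -/
lemma norm_add_le_exp_mul_of_sub_eq_integral {u g : ℝ → E} {a b c K : ℝ} (hab : a ≤ b)
    (hK : 0 ≤ K) (hg : IntervalIntegrable g volume a b)
    (hu : ∀ r ∈ Icc a b, u r = u a + ∫ q in a..r, g q)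
    (hgu : ∀ r ∈ Icc a b, ‖g r‖ ≤ K * (c + ‖u r‖)) :
    c + ‖u b‖ ≤ (c + ‖u a‖) * Real.exp (K * (b - a)) ∧
      c + ‖u a‖ ≤ (c + ‖u b‖) * Real.exp (K * (b - a)) := by
  refine ⟨norm_add_le_exp_mul_of_eq_add_integral hab hK hg hu hgu, ?_⟩
  have hmem : ∀ r ∈ Icc (-b) (-a), -r ∈ Icc a b := fun r hr =>
    ⟨by linarith [hr.2], by linarith [hr.1]⟩
  have h := norm_add_le_exp_mul_of_eq_add_integral (u := fun r => u (-r)) (g := fun r => -g (-r))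
    (x := u b) (a := -b) (b := -a) (c := c) (K := K) (by linarith) hK
    ((IntervalIntegrable.iff_comp_neg (by simp)).1 hg).neg.symm ?_ ?_
  · simpa [neg_neg, add_comm, sub_eq_add_neg] using h
  · intro r hr
    have hr' := hmem r hr
    have h1 := hu (-r) hr'
    have h2 := hu b (right_mem_Icc.2 hab)
    have hsub : IntervalIntegrable g volume a (-r) :=
      hg.mono_set (uIcc_subset_uIcc left_mem_uIcc (by rw [uIcc_of_le hab]; exact hr'))
    have h3 := intervalIntegral.integral_interval_sub_left hg hsub
    have h4 : ∫ q in (-b)..r, -g (-q) = -∫ q in (-r)..b, g q := by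
      rw [intervalIntegral.integral_neg, intervalIntegral.integral_comp_neg, neg_neg]
    simp only [h4, ← h3]
    rw [h1, h2]
    abel
  · intro r hr
    simpa using hgu (-r) (hmem r hr)

variable [MeasurableSpace E] [BorelSpace E] [SecondCountableTopology E]

/-- A solution of an integral equation with measurable right-hand side of linear growth is
a genuine solution: the integrand is automatically integrable. -/
lemma intervalIntegrable_of_eq_add_integral {f : ℝ → E → E} (hf : Measurable (Function.uncurry f))
    {u : ℝ → E} {x : E} {a b c K : ℝ} (hab : a ≤ b) (hK : 0 ≤ K)
    (hgrowth : ∀ r ∈ Icc a b, ∀ z, ‖f r z‖ ≤ K * (c + ‖z‖))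
    (hu : ∀ r ∈ Icc a b, u r = x + ∫ q in a..r, f q (u q)) :
    IntervalIntegrable (fun r => f r (u r)) volume a b := by
  set g : ℝ → E := fun r => f r (u r) with hg
  set B : ℝ := K * ((c + ‖x‖) * Real.exp (K * (b - a))) with hB
  have hgB : ∀ r ∈ Icc a b, IntervalIntegrable g volume a r → ‖g r‖ ≤ B := by
    intro r hr hi
    refine (hgrowth r hr (u r)).trans (mul_le_mul_of_nonneg_left ?_ hK)
    have h1 := norm_add_le_exp_mul_of_eq_add_integral hr.1 hK hi
      (fun q hq => hu q ⟨hq.1, hq.2.trans hr.2⟩)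
      (fun q hq => hgrowth q ⟨hq.1, hq.2.trans hr.2⟩ (u q))
    refine h1.trans ?_
    rcases hK.eq_or_lt with rfl | hK'
    · simp
    have h0 : 0 ≤ c + ‖x‖ := by
      have := (norm_nonneg _).trans (hgrowth a (left_mem_Icc.2 hab) x)
      exact nonneg_of_mul_nonneg_right this hK'
    have := hr.2
    gcongr
  set A : Set ℝ := {r | r ∈ Icc a b ∧ IntervalIntegrable g volume a r} with hA
  have haA : a ∈ A := ⟨left_mem_Icc.2 hab, by simp⟩
  have hbdd : BddAbove A := ⟨b, fun r hr => hr.1.2⟩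
  set m := sSup A with hm
  have ham : a ≤ m := le_csSup hbdd haA
  have hmb : m ≤ b := csSup_le ⟨a, haA⟩ fun r hr => hr.1.2
  have hdown : ∀ r ∈ A, ∀ q ∈ Icc a r, q ∈ A := fun r hr q hq =>
    ⟨⟨hq.1, hq.2.trans hr.1.2⟩, hr.2.mono_set (uIcc_subset_uIcc left_mem_uIcc
      (by rw [uIcc_of_le hr.1.1]; exact hq))⟩
  have hmA : m ∈ A := by
    refine ⟨⟨ham, hmb⟩, ?_⟩
    obtain ⟨w, -, hw, hwA⟩ := exists_seq_tendsto_sSup ⟨a, haA⟩ hbdd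
    rw [intervalIntegrable_iff_integrableOn_Ioc_of_le ham]
    refine integrableOn_Ioc_of_intervalIntegral_norm_bounded_right (l := Filter.atTop)
      (b := w) (I := |B| * (b - a)) (fun i => ?_) hw (.of_forall fun i => ?_)
    · exact (intervalIntegrable_iff_integrableOn_Ioc_of_le (hwA i).1.1).1 (hwA i).2
    · have hi := hwA i
      rw [← intervalIntegral.integral_of_le hi.1.1]
      have h1 : ∫ q in a..w i, ‖g q‖ ≤ ∫ q in a..w i, |B| := by
        refine intervalIntegral.integral_mono_on hi.1.1 hi.2.norm (by simp) fun q hq => ?_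
        have hq' := hdown _ hi q hq
        exact (hgB q hq'.1 hq'.2).trans (le_abs_self B)
      refine h1.trans ?_
      rw [intervalIntegral.integral_const, smul_eq_mul, mul_comm]
      have := hi.1.2
      gcongr
  have hux : ∀ r ∈ Ioc m b, u r = x := by
    intro r hr
    have hr' : r ∈ Icc a b := ⟨ham.trans hr.1.le, hr.2⟩
    rw [hu r hr', intervalIntegral.integral_undef, add_zero]
    exact fun hi => absurd (le_csSup hbdd (show r ∈ A from ⟨hr', hi⟩)) (not_le.2 hr.1)
  have h2 : IntervalIntegrable g volume m b := by
    have h3 : IntervalIntegrable (fun r => f r x) volume m b := by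
      rw [intervalIntegrable_iff_integrableOn_Ioc_of_le hmb]
      refine Measure.integrableOn_of_bounded (M := K * (c + ‖x‖)) (by simp)
        (hf.comp (measurable_id.prodMk measurable_const)).aestronglyMeasurable ?_
      filter_upwards [ae_restrict_mem measurableSet_Ioc] with r hr
      exact hgrowth r ⟨ham.trans hr.1.le, hr.2⟩ x
    refine h3.congr fun r hr => ?_
    rw [uIoc_of_le hmb] at hr
    simp [hg, hux r hr]
  exact hmA.2.trans h2

/-- Backward version of `intervalIntegrable_of_eq_add_integral`. -/
lemma intervalIntegrable_of_eq_add_integral_right {f : ℝ → E → E}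
    (hf : Measurable (Function.uncurry f))
    {u : ℝ → E} {x : E} {a b c K : ℝ} (hab : a ≤ b) (hK : 0 ≤ K)
    (hgrowth : ∀ r ∈ Icc a b, ∀ z, ‖f r z‖ ≤ K * (c + ‖z‖))
    (hu : ∀ r ∈ Icc a b, u r = x + ∫ q in b..r, f q (u q)) :
    IntervalIntegrable (fun r => f r (u r)) volume a b := by
  have hmem : ∀ r ∈ Icc (-b) (-a), -r ∈ Icc a b := fun r hr =>
    ⟨by linarith [hr.2], by linarith [hr.1]⟩
  have h := intervalIntegrable_of_eq_add_integral (f := fun r z => -f (-r) z)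
    (u := fun r => u (-r)) (x := x) (a := -b) (b := -a) (c := c) (K := K)
    (by
      have h1 : Measurable fun p : ℝ × E => (-p.1, p.2) := by fun_prop
      exact (hf.comp h1).neg) (by linarith) hK
    (fun r hr z => by simpa using hgrowth (-r) (hmem r hr) z)
    (fun r hr => by
      rw [hu (-r) (hmem r hr), intervalIntegral.integral_neg,
        intervalIntegral.integral_comp_neg (fun q => f q (u q)), neg_neg,
        intervalIntegral.integral_symm])
  simpa [Pi.neg_def] using ((IntervalIntegrable.iff_comp_neg (by simp)).1 h).neg.symm

end Flow

/-- The `j`-th derivative of a Gaussian exponential, with its natural scaling. -/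
lemma norm_iteratedFDeriv_exp_quadratic_le {E : Type*} [NormedAddCommGroup E]
    [InnerProductSpace ℝ E] (L : E →L[ℝ] E) (hL : ∀ v w, inner ℝ (L v) w = inner ℝ v (L w))
    {k h : ℝ} (hk : 1 ≤ k) (hh : 0 < h) (hLk : ‖L‖ ≤ k / h ^ 2) (m x : E) (j : ℕ) :
    ‖iteratedFDeriv ℝ j (fun z => Real.exp (-(1 / 2) * inner ℝ (L (z - m)) (z - m))) x‖ ≤
      j.factorial * Real.exp (-(1 / 2) * inner ℝ (L (x - m)) (x - m)) *
        (k / h * (1 + ‖x - m‖ / h)) ^ j := by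
  set q : E → ℝ := fun z => -(1 / 2) * inner ℝ (L (z - m)) (z - m) with hq
  set P : E →L[ℝ] E →L[ℝ] ℝ := (innerSL ℝ).comp (-L) with hP
  have hPn : ‖P‖ ≤ k / h ^ 2 := by
    refine ContinuousLinearMap.opNorm_le_bound _ (by positivity) fun v => ?_
    rw [hP, ContinuousLinearMap.comp_apply, innerSL_apply_norm, _root_.neg_apply,
      norm_neg]
    exact (L.le_opNorm v).trans (by gcongr)
  have hq' : fderiv ℝ q = fun z => P (z - m) := by
    funext z
    have h1 : HasFDerivAt (fun z : E => z - m) (ContinuousLinearMap.id ℝ E) z :=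
      (hasFDerivAt_id z).sub_const m
    have h2 : HasFDerivAt (fun z : E => L (z - m)) L z := L.hasFDerivAt.comp z h1
    refine ((h2.inner ℝ h1).const_mul (-(1 / 2))).fderiv.trans ?_
    ext v
    have h3 : inner ℝ (L v) (z - m) = inner ℝ (L (z - m)) v := by rw [hL, real_inner_comm]
    simp [-map_sub, hP, h3]
    ring
  have hqs : ContDiff ℝ (⊤ : ℕ∞) q := by
    have h1 : ContDiff ℝ (⊤ : ℕ∞) fun z : E => z - m := contDiff_id.sub contDiff_const
    exact contDiff_const.mul ((L.contDiff.comp h1).inner ℝ h1)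
  have hP1 : fderiv ℝ (fun z => P (z - m)) = fun _ => P := by
    funext z
    exact (P.hasFDerivAt.comp z ((hasFDerivAt_id z).sub_const m)).fderiv
  set D : ℝ := k / h * (1 + ‖x - m‖ / h) with hD
  have hz : 0 ≤ ‖x - m‖ / h := by positivity
  have hkh : 0 < k / h := by positivity
  have hDq : ∀ i, 1 ≤ i → i ≤ j → ‖iteratedFDeriv ℝ i q x‖ ≤ D ^ i := by
    intro i hi _
    obtain ⟨i, rfl⟩ := Nat.exists_eq_add_of_le' hi
    rw [← norm_iteratedFDeriv_fderiv, hq']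
    rcases i with - | i
    · rw [norm_iteratedFDeriv_zero, zero_add, pow_one]
      calc ‖P (x - m)‖ ≤ k / h ^ 2 * ‖x - m‖ := (P.le_opNorm _).trans (by gcongr)
        _ = k / h * (‖x - m‖ / h) := by field_simp
        _ ≤ D := by rw [hD]; gcongr; linarith
    · rw [← norm_iteratedFDeriv_fderiv, hP1]
      rcases i with - | i
      · rw [norm_iteratedFDeriv_zero]
        calc ‖P‖ ≤ k / h ^ 2 := hPn
          _ ≤ k * k / h ^ 2 := by gcongr; nlinarith
          _ = (k / h * 1) ^ (0 + 1 + 1) := by rw [mul_one, zero_add, one_add_one_eq_two]; ring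
          _ ≤ D ^ (0 + 1 + 1) := by rw [hD]; gcongr; linarith
      · rw [iteratedFDeriv_succ_const]
        simpa using (by positivity : 0 ≤ D ^ (i + 1 + 1 + 1))
  refine norm_iteratedFDeriv_comp_le (g := Real.exp) (f := q) (N := (⊤ : ℕ∞)) (n := j)
    Real.contDiff_exp hqs (by exact_mod_cast le_top) x (fun i _ => ?_) hDq
  rw [norm_iteratedFDeriv_eq_norm_iteratedDeriv, iteratedDeriv_eq_iterate, Real.iter_deriv_exp,
    Real.norm_eq_abs, abs_of_pos (Real.exp_pos _)]

section Matrices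

variable {n : Type*} [Fintype n] [DecidableEq n]

/-- Two-sided bounds on the determinant of a symmetric matrix with a pinched quadratic form. -/
lemma Matrix.IsHermitian.pow_le_det_le_pow {M : Matrix n n ℝ} (hM : M.IsHermitian) {a b : ℝ}
    (ha : 0 ≤ a) (h : ∀ v : n → ℝ, a * (v ⬝ᵥ v) ≤ M *ᵥ v ⬝ᵥ v ∧ M *ᵥ v ⬝ᵥ v ≤ b * (v ⬝ᵥ v)) :
    a ^ Fintype.card n ≤ M.det ∧ M.det ≤ b ^ Fintype.card n := by
  have he : ∀ i, a ≤ hM.eigenvalues i ∧ hM.eigenvalues i ≤ b := by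
    intro i
    have h1 := h (hM.eigenvectorBasis i)
    have h2 : (hM.eigenvectorBasis i : n → ℝ) ⬝ᵥ (hM.eigenvectorBasis i) = 1 := by
      have := hM.eigenvectorBasis.orthonormal.1 i
      have h3 := real_inner_self_eq_norm_sq (hM.eigenvectorBasis i)
      rw [this, EuclideanSpace.inner_eq_star_dotProduct] at h3
      simpa using h3
    have h3 := hM.eigenvalues_eq i
    rw [dotProduct_comm] at h3
    simp only [star_trivial, RCLike.re_to_real] at h3
    rw [h2, ← h3, mul_one, mul_one] at h1
    exact h1
  rw [hM.det_eq_prod_eigenvalues, ← Finset.card_univ, ← Finset.prod_const, ← Finset.prod_const]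
  exact ⟨Finset.prod_le_prod (fun _ _ => ha) fun i _ => (he i).1,
    Finset.prod_le_prod (fun i _ => ha.trans (he i).1) fun i _ => (he i).2⟩

lemma Matrix.IsHermitian.inner_toEuclideanCLM_left {M : Matrix n n ℝ} (hM : M.IsHermitian)
    (v w : EuclideanSpace ℝ n) :
    inner ℝ (toEuclideanCLM (𝕜 := ℝ) M v) w = inner ℝ v (toEuclideanCLM (𝕜 := ℝ) M w) := by
  rw [real_inner_comm, inner_toEuclideanCLM, inner_toEuclideanCLM, dotProduct_mulVec,
    ← mulVec_transpose, dotProduct_comm]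
  congr 2

/-- The inverse of a symmetric matrix with a pinched quadratic form, as an operator. -/
lemma Matrix.IsHermitian.inv_bounds {M : Matrix n n ℝ} (hM : M.IsHermitian) {a b : ℝ}
    (ha : 0 < a) (hb : 0 < b)
    (h : ∀ v : n → ℝ, a * (v ⬝ᵥ v) ≤ M *ᵥ v ⬝ᵥ v ∧ M *ᵥ v ⬝ᵥ v ≤ b * (v ⬝ᵥ v)) :
    ‖toEuclideanCLM (𝕜 := ℝ) M⁻¹‖ ≤ a⁻¹ ∧
      ∀ v : EuclideanSpace ℝ n,
        b⁻¹ * ‖v‖ ^ 2 ≤ inner ℝ (toEuclideanCLM (𝕜 := ℝ) M⁻¹ v) v ∧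
        inner ℝ (toEuclideanCLM (𝕜 := ℝ) M⁻¹ v) v ≤ a⁻¹ * ‖v‖ ^ 2 := by
  have hdet : IsUnit M.det :=
    ((pow_pos ha _).trans_le (hM.pow_le_det_le_pow ha.le h).1).ne'.isUnit
  set A := toEuclideanCLM (𝕜 := ℝ) M with hA
  set L := toEuclideanCLM (𝕜 := ℝ) M⁻¹ with hL
  have hAL : ∀ v, A (L v) = v := by
    intro v
    have : A * L = 1 := by rw [hA, hL, ← map_mul, Matrix.mul_nonsing_inv _ hdet, map_one]
    simpa using congrArg (fun B => B v) this
  have hform : ∀ v, a * ‖v‖ ^ 2 ≤ inner ℝ v (A v) ∧ inner ℝ v (A v) ≤ b * ‖v‖ ^ 2 := by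
    intro v
    have h1 := h v
    have h2 : ‖v‖ ^ 2 = (v : n → ℝ) ⬝ᵥ v := by
      rw [← real_inner_self_eq_norm_sq, EuclideanSpace.inner_eq_star_dotProduct]; simp
    rw [inner_toEuclideanCLM, h2, dotProduct_comm _ (M *ᵥ _)]
    exact h1
  have hAs : ∀ v w, inner ℝ (A v) w = inner ℝ v (A w) := hM.inner_toEuclideanCLM_left
  have hLn : ∀ v, ‖L v‖ ≤ a⁻¹ * ‖v‖ := by
    intro v
    have h1 := (hform (L v)).1
    rw [hAL] at h1
    have h2 := h1.trans (real_inner_le_norm _ _)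
    rcases (norm_nonneg (L v)).eq_or_lt with h0 | h0
    · rw [← h0]; positivity
    · rw [inv_mul_eq_div, le_div_iff₀ ha]
      nlinarith
  refine ⟨ContinuousLinearMap.opNorm_le_bound _ (by positivity) hLn, fun v => ⟨?_, ?_⟩⟩
  · have h1 := (hform (v - b • L v)).1
    have h0 : 0 ≤ a * ‖v - b • L v‖ ^ 2 := by positivity
    have h2 := (hform v).2
    have h3 : inner ℝ (L v) (A v) = ‖v‖ ^ 2 := by
      rw [← hAs, hAL, real_inner_self_eq_norm_sq]
    rw [map_sub, map_smul, hAL, inner_sub_left, inner_sub_right, inner_sub_right,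
      real_inner_smul_left, real_inner_smul_left, real_inner_smul_right, real_inner_smul_right,
      real_inner_self_eq_norm_sq, h3] at h1
    rw [inv_mul_le_iff₀ hb]
    nlinarith
  · calc inner ℝ (L v) v ≤ ‖L v‖ * ‖v‖ := real_inner_le_norm _ _
      _ ≤ a⁻¹ * ‖v‖ * ‖v‖ := by gcongr; exact hLn v
      _ = a⁻¹ * ‖v‖ ^ 2 := by ring

end Matrices

section Drift

variable {d : ℕ} {b : ℝ → Vec d → Vec d} {κ₁ β : ℝ} {ρ : Vec d → ℝ}

lemma HolderDrift.norm_sub_le (hb : HolderDrift d b κ₁ β) (hβ : β ∈ Icc (0 : ℝ) 1)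
    (hκ₁ : 0 ≤ κ₁) {t : ℝ} (ht : 0 ≤ t) (x y : Vec d) :
    ‖b t x - b t y‖ ≤ κ₁ * max 1 ‖x - y‖ := by
  refine (hb.2.2 t ht x y).trans (mul_le_mul_of_nonneg_left ?_ hκ₁)
  refine max_le ?_ (le_max_right _ _)
  rcases le_total ‖x - y‖ 1 with h | h
  · exact (Real.rpow_le_one (norm_nonneg _) h hβ.1).trans (le_max_left _ _)
  · refine le_trans ?_ (le_max_right _ _)
    simpa using Real.rpow_le_rpow_of_exponent_le h hβ.2

lemma HolderDrift.norm_sub_le_add (hb : HolderDrift d b κ₁ β) (hβ : β ∈ Icc (0 : ℝ) 1)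
    (hκ₁ : 0 ≤ κ₁) {t : ℝ} (ht : 0 ≤ t) (x y : Vec d) :
    ‖b t x - b t y‖ ≤ κ₁ * (1 + ‖x - y‖) :=
  (hb.norm_sub_le hβ hκ₁ ht x y).trans <| mul_le_mul_of_nonneg_left
    (max_le (by linarith [norm_nonneg (x - y)]) (by linarith)) hκ₁

lemma HolderDrift.norm_le (hb : HolderDrift d b κ₁ β) (hβ : β ∈ Icc (0 : ℝ) 1)
    (hκ₁ : 0 ≤ κ₁) {t : ℝ} (ht : 0 ≤ t) (x : Vec d) : ‖b t x‖ ≤ κ₁ * (2 + ‖x‖) := by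
  have h1 := hb.norm_sub_le_add hβ hκ₁ ht x 0
  rw [sub_zero] at h1
  have h2 := norm_sub_norm_le (b t x) (b t 0)
  have h3 := hb.2.1 t ht
  linarith

lemma IsMollifier.continuous (hρ : IsMollifier d ρ) : Continuous ρ := hρ.smooth.continuous

lemma mollifiedDrift_one (t : ℝ) (x : Vec d) :
    mollifiedDrift d ρ 1 b t x = ∫ y, ρ (x - y) • b t y := by
  simp [mollifiedDrift]

lemma IsMollifier.measurable_mollifiedDrift (hρ : IsMollifier d ρ)
    (hb : Measurable (Function.uncurry b)) :
    Measurable (Function.uncurry (mollifiedDrift d ρ 1 b)) := by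
  have h1 : Measurable fun p : (ℝ × Vec d) × Vec d => ρ (p.1.2 - p.2) • b p.1.1 p.2 := by
    have h2 : Measurable fun p : (ℝ × Vec d) × Vec d => ρ (p.1.2 - p.2) :=
      hρ.continuous.measurable.comp (by fun_prop)
    have h3 : Measurable fun p : (ℝ × Vec d) × Vec d => b p.1.1 p.2 :=
      hb.comp (f := fun p : (ℝ × Vec d) × Vec d => (p.1.1, p.2)) (by fun_prop)
    exact h2.smul h3
  have h4 := (h1.stronglyMeasurable.integral_prod_right' (ν := (volume : Measure (Vec d)))).measurable
  convert h4 using 1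
  funext p
  exact mollifiedDrift_one p.1 p.2

/-- Mollification at unit scale moves a drift with bounded local oscillation by a bounded amount. -/
lemma IsMollifier.norm_mollifiedDrift_sub_le (hρ : IsMollifier d ρ) (hb : HolderDrift d b κ₁ β)
    (hβ : β ∈ Icc (0 : ℝ) 1) (hκ₁ : 0 ≤ κ₁) {t : ℝ} (ht : 0 ≤ t) (hbt : Continuous (b t))
    (x : Vec d) : ‖mollifiedDrift d ρ 1 b t x - b t x‖ ≤ κ₁ := by
  have hsupp : ∀ y, ρ (x - y) ≠ 0 → ‖y - x‖ ≤ 1 := by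
    intro y hy
    have := hρ.support_subset (Function.mem_support.2 hy)
    rwa [mem_closedBall_zero_iff, norm_sub_rev] at this
  have hcs : ∀ w : Vec d → Vec d, HasCompactSupport fun y => ρ (x - y) • w y := fun w =>
    HasCompactSupport.of_support_subset_isCompact (isCompact_closedBall x 1) fun y hy => by
      rw [mem_closedBall_iff_norm]
      refine hsupp y fun h => hy ?_
      simp [h]
  have hρx : Continuous fun y => ρ (x - y) := hρ.continuous.comp (by fun_prop)
  have hρi : Integrable fun y => ρ (x - y) := by
    refine Integrable.comp_sub_left (f := ρ) ?_ x
    exact hρ.continuous.integrable_of_hasCompactSupport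
      (HasCompactSupport.of_support_subset_isCompact (isCompact_closedBall 0 1) hρ.support_subset)
  have hρ1 : ∫ y, ρ (x - y) = 1 := by
    rw [integral_sub_left_eq_self ρ, hρ.integral_eq_one]
  have h1 : mollifiedDrift d ρ 1 b t x - b t x = ∫ y, ρ (x - y) • (b t y - b t x) := by
    have h2 : ∫ y, ρ (x - y) • b t x = b t x := by
      rw [integral_smul_const, hρ1, one_smul]
    simp only [smul_sub]
    rw [mollifiedDrift_one, integral_sub, h2]
    · exact (hρx.smul hbt).integrable_of_hasCompactSupport (hcs _)
    · exact (hρx.smul continuous_const).integrable_of_hasCompactSupport (hcs _)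
  rw [h1]
  have h3 : ∫ y, ρ (x - y) * κ₁ = κ₁ := by rw [integral_mul_const, hρ1, one_mul]
  rw [← h3]
  refine norm_integral_le_of_norm_le (hρi.mul_const κ₁) (.of_forall fun y => ?_)
  rw [norm_smul, Real.norm_of_nonneg (hρ.nonneg _)]
  by_cases hy : ρ (x - y) = 0
  · simp [hy]
  · refine mul_le_mul_of_nonneg_left ?_ (hρ.nonneg _)
    have := hb.norm_sub_le hβ hκ₁ ht y x
    rwa [max_eq_left (hsupp y hy), mul_one] at this

variable {θ θ1 : ℝ → ℝ → Vec d → Vec d}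

lemma IsFlow.intervalIntegrable_backward (hθ : IsFlow d b θ) (hb : HolderDrift d b κ₁ β)
    (hβ : β ∈ Icc (0 : ℝ) 1) (hκ₁ : 0 ≤ κ₁) {s t : ℝ} (hs : 0 ≤ s) (hst : s ≤ t) (y : Vec d) :
    IntervalIntegrable (fun r => b r (θ r t y)) volume s t :=
  intervalIntegrable_of_eq_add_integral_right hb.1 (u := fun r => θ r t y) (x := y) hst hκ₁
    (fun _ hr z => hb.norm_le hβ hκ₁ (hs.trans hr.1) z)
    fun r hr => hθ t r (hs.trans hst) (hs.trans hr.1) y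

/-- The backward flow of the drift and the forward flow of its unit-scale mollification are
comparable, with constants that do not see the regularity of the drift. -/
lemma IsFlow.norm_sub_comparison (hρ : IsMollifier d ρ) (hb : HolderDrift d b κ₁ β)
    (hβ : β ∈ Icc (0 : ℝ) 1) (hκ₁ : 0 ≤ κ₁) (hbt : ∀ t, Continuous (b t))
    (hθ : IsFlow d b θ) (hθ1 : IsFlow d (mollifiedDrift d ρ 1 b) θ1)
    {s t : ℝ} (hs : 0 ≤ s) (hst : s ≤ t) (x y : Vec d) :
    2 + ‖θ1 t s x - y‖ ≤ (2 + ‖x - θ s t y‖) * Real.exp (κ₁ * (t - s)) ∧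
      2 + ‖x - θ s t y‖ ≤ (2 + ‖θ1 t s x - y‖) * Real.exp (κ₁ * (t - s)) := by
  have ht : 0 ≤ t := hs.trans hst
  have hmoll : ∀ r, 0 ≤ r → ∀ z, ‖mollifiedDrift d ρ 1 b r z - b r z‖ ≤ κ₁ :=
    fun r hr z => hρ.norm_mollifiedDrift_sub_le hb hβ hκ₁ hr (hbt r) z
  have hi1 : IntervalIntegrable (fun r => mollifiedDrift d ρ 1 b r (θ1 r s x)) volume s t := by
    refine intervalIntegrable_of_eq_add_integral (hρ.measurable_mollifiedDrift hb.1)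
      (u := fun r => θ1 r s x) (x := x) (c := 3) hst hκ₁ (fun r hr z => ?_)
      fun r hr => hθ1 s r hs (hs.trans hr.1) x
    have h1 := hmoll r (hs.trans hr.1) z
    have h2 := hb.norm_le hβ hκ₁ (hs.trans hr.1) z
    have h3 := norm_sub_norm_le (mollifiedDrift d ρ 1 b r z) (b r z)
    linarith
  have hi2 := hθ.intervalIntegrable_backward hb hβ hκ₁ hs hst y
  have hself : ∀ f : ℝ → Vec d → Vec d, ∀ ψ, IsFlow d f ψ → ∀ r, 0 ≤ r → ∀ z, ψ r r z = z := by
    intro f ψ hψ r hr z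
    rw [hψ r r hr hr z, intervalIntegral.integral_same, add_zero]
  have h := norm_add_le_exp_mul_of_sub_eq_integral (u := fun r => θ1 r s x - θ r t y)
    (g := fun r => mollifiedDrift d ρ 1 b r (θ1 r s x) - b r (θ r t y)) (c := 2) hst hκ₁
    (hi1.sub hi2) ?_ ?_
  · simpa only [hself _ _ hθ t ht y, hself _ _ hθ1 s hs x] using h
  · intro r hr
    have hmem : r ∈ uIcc s t := by rw [uIcc_of_le hst]; exact hr
    have hi1' := hi1.mono_set (uIcc_subset_uIcc left_mem_uIcc hmem)
    have hi2' := hi2.mono_set (uIcc_subset_uIcc left_mem_uIcc hmem)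
    have h1 := hθ1 s r hs (hs.trans hr.1) x
    have h2 := hθ t r ht (hs.trans hr.1) y
    have h3 := hθ t s ht hs y
    have h4 := intervalIntegral.integral_add_adjacent_intervals hi2.symm hi2'
    rw [intervalIntegral.integral_sub hi1' hi2', h1, h2, ← h4, hself _ _ hθ1 s hs x]
    rw [h3]
    abel
  · intro r hr
    have h1 := hmoll r (hs.trans hr.1) (θ1 r s x)
    have h2 := hb.norm_sub_le_add hβ hκ₁ (hs.trans hr.1) (θ1 r s x) (θ r t y)
    have h3 := norm_sub_le_norm_sub_add_norm_sub (mollifiedDrift d ρ 1 b r (θ1 r s x))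
      (b r (θ1 r s x)) (b r (θ r t y))
    linarith

end Drift

section Covariance

variable {d : ℕ} {σ : ℝ → Vec d → Matrix (Fin d) (Fin d) ℝ} {κ₀ α : ℝ}

lemma isHermitian_sqMat (t : ℝ) (x : Vec d) : (sqMat d σ t x).IsHermitian := by
  simpa [sqMat] using isHermitian_mul_conjTranspose_self (σ t x)

lemma EllipticHolder.abs_sqMat_le (hσ : EllipticHolder d σ κ₀ α) {t : ℝ} (ht : 0 ≤ t) (x : Vec d)
    (i j : Fin d) : |sqMat d σ t x i j| ≤ κ₀ := by
  have hdiag : ∀ i, ∑ k, σ t x i k ^ 2 ≤ κ₀ := by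
    intro i
    have h := (hσ.2.1 t ht x (Pi.single i 1)).2
    simpa [sqMat, Matrix.mul_apply, ← pow_two] using h
  have h1 : |sqMat d σ t x i j| ≤ ∑ k, (σ t x i k ^ 2 + σ t x j k ^ 2) / 2 := by
    rw [sqMat, Matrix.mul_apply]
    refine (Finset.abs_sum_le_sum_abs _ _).trans (Finset.sum_le_sum fun k _ => ?_)
    rw [transpose_apply, abs_le]
    constructor <;> nlinarith [sq_nonneg (σ t x i k - σ t x j k), sq_nonneg (σ t x i k + σ t x j k)]
  rw [← Finset.sum_div, Finset.sum_add_distrib] at h1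
  linarith [hdiag i, hdiag j]

/-- The frozen covariance is symmetric, with quadratic form pinched by the ellipticity. -/
lemma EllipticHolder.freezeCov_bounds (hσ : EllipticHolder d σ κ₀ α)
    {θ : ℝ → ℝ → Vec d → Vec d} {τ s t : ℝ} {ξ : Vec d} (hs : 0 ≤ s) (hst : s ≤ t)
    (hθ : ContinuousOn (fun r => θ r τ ξ) (Icc s t)) :
    (freezeCov d σ θ τ ξ s t).IsHermitian ∧ ∀ v : Fin d → ℝ,
      κ₀⁻¹ * (t - s) * (v ⬝ᵥ v) ≤ freezeCov d σ θ τ ξ s t *ᵥ v ⬝ᵥ v ∧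
        freezeCov d σ θ τ ξ s t *ᵥ v ⬝ᵥ v ≤ κ₀ * (t - s) * (v ⬝ᵥ v) := by
  have hint : ∀ i j, IntervalIntegrable (fun r => sqMat d σ r (θ r τ ξ) i j) volume s t := by
    intro i j
    rw [intervalIntegrable_iff_integrableOn_Ioc_of_le hst]
    refine Integrable.of_bound (C := κ₀) ?_ ?_
    · have h1 : Measurable fun p : ℝ × Vec d => sqMat d σ p.1 p.2 i j := by
        simp only [sqMat, Matrix.mul_apply, transpose_apply]
        exact Finset.measurable_sum _ fun k _ => (hσ.1 i k).mul (hσ.1 j k)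
      have h2 : AEMeasurable (fun r => θ r τ ξ) (volume.restrict (Ioc s t)) :=
        (hθ.mono Ioc_subset_Icc_self).aemeasurable measurableSet_Ioc
      exact (h1.comp_aemeasurable (aemeasurable_id.prodMk h2)).aestronglyMeasurable
    · filter_upwards [ae_restrict_mem measurableSet_Ioc] with r hr
      exact hσ.abs_sqMat_le (hs.trans hr.1.le) _ i j
  have hsum : ∀ f : Fin d → ℝ → ℝ, (∀ i, IntervalIntegrable (f i) volume s t) →
      IntervalIntegrable (fun r => ∑ i, f i r) volume s t := fun f hf => by
    simpa only [Finset.sum_fn] using IntervalIntegrable.sum Finset.univ fun i _ => hf i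
  refine ⟨?_, fun v => ?_⟩
  · refine IsHermitian.ext fun i j => ?_
    simp only [freezeCov, of_apply, star_trivial]
    congr 1
    funext r
    exact ((isHermitian_sqMat r (θ r τ ξ)).apply i j)
  have hform : freezeCov d σ θ τ ξ s t *ᵥ v ⬝ᵥ v =
      ∫ r in s..t, sqMat d σ r (θ r τ ξ) *ᵥ v ⬝ᵥ v := by
    simp only [dotProduct, mulVec, freezeCov, of_apply]
    have h1 : ∀ i, IntervalIntegrable (fun r => ∑ j, sqMat d σ r (θ r τ ξ) i j * v j) volume s t :=
      fun i => hsum _ fun j => (hint i j).mul_const _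
    rw [intervalIntegral.integral_finsetSum fun i _ => (h1 i).mul_const _]
    refine Finset.sum_congr rfl fun i _ => ?_
    rw [intervalIntegral.integral_mul_const,
      intervalIntegral.integral_finsetSum fun j _ => (hint i j).mul_const _]
    simp only [intervalIntegral.integral_mul_const]
  have hfint : IntervalIntegrable (fun r => sqMat d σ r (θ r τ ξ) *ᵥ v ⬝ᵥ v) volume s t := by
    simp only [dotProduct, mulVec]
    exact hsum _ fun i => (hsum _ fun j => (hint i j).mul_const _).mul_const _
  have hconst : ∀ c : ℝ, c * (t - s) * (v ⬝ᵥ v) = ∫ _ in s..t, c * (v ⬝ᵥ v) := by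
    intro c
    rw [intervalIntegral.integral_const, smul_eq_mul]
    ring
  rw [hform, hconst, hconst]
  exact ⟨intervalIntegral.integral_mono_on hst (by simp) hfint fun r hr =>
      (hσ.2.1 r (hs.trans hr.1) _ v).1,
    intervalIntegral.integral_mono_on hst hfint (by simp) fun r hr =>
      (hσ.2.1 r (hs.trans hr.1) _ v).2⟩

end Covariance

section GaussianBounds

lemma rpow_neg_natCast_div_two {r : ℝ} (hr : 0 ≤ r) (d : ℕ) :
    r ^ (-(d : ℝ) / 2) = (Real.sqrt (r ^ d))⁻¹ := by
  rw [neg_div, Real.rpow_neg hr, Real.sqrt_eq_rpow, ← Real.rpow_natCast, ← Real.rpow_mul hr,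
    mul_one_div]

/-- A polynomial is absorbed by half of a Gaussian exponent. -/
lemma one_add_pow_mul_exp_le {z κ : ℝ} (hz : 0 ≤ z) (hκ : 0 < κ) (n : ℕ) :
    (1 + z) ^ n * Real.exp (-(z ^ 2 / (2 * κ))) ≤
      Real.exp (κ * n ^ 2) * Real.exp (-(z ^ 2 / (4 * κ))) := by
  have h1 : (1 + z) ^ n ≤ Real.exp (n * z) := by
    rw [Real.exp_nat_mul]
    exact pow_le_pow_left₀ (by positivity) (by linarith [Real.add_one_le_exp z]) n
  calc (1 + z) ^ n * Real.exp (-(z ^ 2 / (2 * κ)))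
      ≤ Real.exp (n * z) * Real.exp (-(z ^ 2 / (2 * κ))) := by gcongr
    _ ≤ _ := by
      rw [← Real.exp_add, ← Real.exp_add, Real.exp_le_exp]
      have h2 : κ * n ^ 2 + -(z ^ 2 / (4 * κ)) - (n * z + -(z ^ 2 / (2 * κ))) =
          (2 * κ * n - z) ^ 2 / (4 * κ) := by
        field_simp
        ring
      have h3 : 0 ≤ (2 * κ * n - z) ^ 2 / (4 * κ) := by positivity
      linarith

/-- Passing from an exponential comparison of lengths to parabolically scaled squares. -/
lemma sq_div_le_of_two_add_le {p q k τ T : ℝ} (hp : 0 ≤ p) (hq : 0 ≤ q) (hk : 0 ≤ k) (hτ : 0 < τ)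
    (hT : τ ≤ T) (h : 2 + p ≤ (2 + q) * Real.exp (k * τ)) :
    p ^ 2 / τ ≤ 2 * Real.exp (k * T) ^ 2 * (q ^ 2 / τ) + 8 * Real.exp (k * T) ^ 2 * k ^ 2 * T := by
  set e := Real.exp (k * T) with he
  have h1 : Real.exp (k * τ) ≤ e := Real.exp_le_exp.2 (by gcongr)
  have h2 : Real.exp (k * τ) - 1 ≤ k * τ * e := by
    have h3 := Real.one_sub_le_exp_neg (k * τ)
    have h4 : Real.exp (-(k * τ)) * Real.exp (k * τ) = 1 := by rw [← Real.exp_add]; simp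
    have h5 : 0 < Real.exp (k * τ) := Real.exp_pos _
    have h6 : 0 ≤ k * τ := by positivity
    nlinarith
  have h3 : p ≤ e * (q + 2 * k * τ) := by nlinarith
  have h4 : p ^ 2 ≤ 2 * e ^ 2 * q ^ 2 + 8 * e ^ 2 * k ^ 2 * τ * τ := by
    have h5 : p ^ 2 ≤ (e * (q + 2 * k * τ)) ^ 2 := pow_le_pow_left₀ hp h3 2
    nlinarith [mul_nonneg (sq_nonneg e) (sq_nonneg (q - 2 * k * τ))]
  calc p ^ 2 / τ ≤ (2 * e ^ 2 * q ^ 2 + 8 * e ^ 2 * k ^ 2 * τ * τ) / τ := by gcongr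
    _ = 2 * e ^ 2 * (q ^ 2 / τ) + 8 * e ^ 2 * k ^ 2 * τ := by field_simp
    _ ≤ _ := by gcongr

variable {d : ℕ} {M : Matrix (Fin d) (Fin d) ℝ} {κ τ : ℝ}

/-- Normalising constants of Gaussians with uniformly elliptic covariance. -/
lemma Matrix.IsHermitian.normalization_bounds (hM : M.IsHermitian) (hκ : 0 < κ) (hτ : 0 < τ)
    (h : ∀ v : Fin d → ℝ, κ⁻¹ * τ * (v ⬝ᵥ v) ≤ M *ᵥ v ⬝ᵥ v ∧ M *ᵥ v ⬝ᵥ v ≤ κ * τ * (v ⬝ᵥ v)) :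
    (Real.sqrt ((2 * Real.pi * κ) ^ d))⁻¹ * τ ^ (-(d : ℝ) / 2) ≤
        (Real.sqrt ((2 * Real.pi) ^ d * M.det))⁻¹ ∧
      (Real.sqrt ((2 * Real.pi) ^ d * M.det))⁻¹ ≤
        (Real.sqrt ((2 * Real.pi * κ⁻¹) ^ d))⁻¹ * τ ^ (-(d : ℝ) / 2) := by
  have hdet := hM.pow_le_det_le_pow (by positivity) h
  rw [Fintype.card_fin] at hdet
  have hd0 : 0 < M.det := lt_of_lt_of_le (by positivity) hdet.1
  have hπ := Real.pi_pos
  rw [rpow_neg_natCast_div_two hτ.le, ← mul_inv, ← mul_inv, ← Real.sqrt_mul (by positivity),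
    ← Real.sqrt_mul (by positivity)]
  have hsplit : ∀ c : ℝ, (2 * Real.pi * c) ^ d * τ ^ d = (2 * Real.pi) ^ d * (c * τ) ^ d :=
    fun c => by rw [← mul_pow, ← mul_pow, mul_assoc _ c]
  rw [hsplit, hsplit]
  constructor
  · refine inv_anti₀ (Real.sqrt_pos.2 (by positivity)) (Real.sqrt_le_sqrt ?_)
    exact mul_le_mul_of_nonneg_left hdet.2 (by positivity)
  · refine inv_anti₀ (Real.sqrt_pos.2 (by positivity)) (Real.sqrt_le_sqrt ?_)
    exact mul_le_mul_of_nonneg_left hdet.1 (by positivity)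

/-- Derivative bound, weighted by a power of the distance to the mean, for Gaussians with
uniformly elliptic covariance. -/
lemma Matrix.IsHermitian.weighted_iteratedFDeriv_gaussian_le (hM : M.IsHermitian) (hκ : 1 ≤ κ)
    (hτ : 0 < τ)
    (h : ∀ v : Fin d → ℝ, κ⁻¹ * τ * (v ⬝ᵥ v) ≤ M *ᵥ v ⬝ᵥ v ∧ M *ᵥ v ⬝ᵥ v ≤ κ * τ * (v ⬝ᵥ v))
    (m x : Vec d) (j : ℕ) {γ : ℝ} (hγ : γ ∈ Icc (0 : ℝ) 1) :
    ‖x - m‖ ^ γ * ‖iteratedFDeriv ℝ j (fun z => Real.exp (-(1 / 2) *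
      inner ℝ (toEuclideanCLM (𝕜 := ℝ) M⁻¹ (z - m)) (z - m))) x‖ ≤
      j.factorial * κ ^ j * Real.exp (κ * (j + 1 : ℕ) ^ 2) * τ ^ ((γ - j) / 2) *
        Real.exp (-(‖x - m‖ ^ 2 / τ / (4 * κ))) := by
  have hκ0 : 0 < κ := by linarith
  set r := Real.sqrt τ with hr
  have hr0 : 0 < r := Real.sqrt_pos.2 hτ
  have hr2 : r ^ 2 = τ := Real.sq_sqrt hτ.le
  obtain ⟨hn, hq⟩ := hM.inv_bounds (by positivity) (by positivity) h
  set L := toEuclideanCLM (𝕜 := ℝ) M⁻¹ with hL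
  have hD := norm_iteratedFDeriv_exp_quadratic_le L hM.inv.inner_toEuclideanCLM_left hκ hr0
    (hn.trans_eq (by rw [hr2]; field_simp)) m x j
  set z := ‖x - m‖ / r with hz
  have hz0 : 0 ≤ z := by positivity
  have hz2 : z ^ 2 = ‖x - m‖ ^ 2 / τ := by rw [hz, div_pow, hr2]
  have hexp : Real.exp (-(1 / 2) * inner ℝ (L (x - m)) (x - m)) ≤
      Real.exp (-(z ^ 2 / (2 * κ))) := by
    rw [Real.exp_le_exp, hz2]
    have := (hq (x - m)).1
    have h2 : ‖x - m‖ ^ 2 / τ / (2 * κ) = 1 / 2 * ((κ * τ)⁻¹ * ‖x - m‖ ^ 2) := by field_simp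
    linarith
  have hpow : ‖x - m‖ ^ γ ≤ r ^ γ * (1 + z) := by
    have h1 : ‖x - m‖ = r * z := by rw [hz]; field_simp
    rw [h1, Real.mul_rpow hr0.le hz0]
    gcongr
    calc z ^ γ ≤ (1 + z) ^ γ := Real.rpow_le_rpow hz0 (by linarith) hγ.1
      _ ≤ (1 + z) ^ (1 : ℝ) := Real.rpow_le_rpow_of_exponent_le (by linarith) hγ.2
      _ = 1 + z := Real.rpow_one _
  have hτr : τ ^ ((γ - j) / 2) = r ^ γ * (r⁻¹) ^ j := by
    rw [hr, Real.sqrt_eq_rpow, inv_pow, ← Real.rpow_natCast, ← Real.rpow_mul hτ.le,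
      ← Real.rpow_mul hτ.le, ← Real.rpow_neg hτ.le, ← Real.rpow_add hτ]
    congr 1
    ring
  calc _ ≤ r ^ γ * (1 + z) * (j.factorial * Real.exp (-(z ^ 2 / (2 * κ))) *
        (κ / r * (1 + z)) ^ j) := by
        refine mul_le_mul hpow (hD.trans ?_) (norm_nonneg _) (by positivity)
        gcongr
    _ = j.factorial * κ ^ j * (r ^ γ * (r⁻¹) ^ j) *
        ((1 + z) ^ (j + 1) * Real.exp (-(z ^ 2 / (2 * κ)))) := by
        rw [mul_pow, div_pow, inv_pow]; ring
    _ ≤ j.factorial * κ ^ j * (r ^ γ * (r⁻¹) ^ j) *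
        (Real.exp (κ * (j + 1 : ℕ) ^ 2) * Real.exp (-(z ^ 2 / (4 * κ)))) := by
        gcongr _ * ?_
        exact one_add_pow_mul_exp_le hz0 hκ0 (j + 1)
    _ = _ := by rw [hτr, hz2]; ring

end GaussianBounds

lemma IsFlow.freezeMean_add_sub {d : ℕ} {b : ℝ → Vec d → Vec d} {θ : ℝ → ℝ → Vec d → Vec d}
    (hθ : IsFlow d b θ) {s t : ℝ} (hs : 0 ≤ s) (ht : 0 ≤ t) (x y : Vec d) :
    freezeMean d b θ t y s t + x - y = x - θ s t y := by
  rw [freezeMean, hθ t s ht hs y, intervalIntegral.integral_symm]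
  abel

lemma IsFlow.frozenDensity_eq {d : ℕ} {b : ℝ → Vec d → Vec d}
    (σ : ℝ → Vec d → Matrix (Fin d) (Fin d) ℝ) {θ : ℝ → ℝ → Vec d → Vec d}
    (hθ : IsFlow d b θ) {s t : ℝ} (hs : 0 ≤ s) (ht : 0 ≤ t) (x y : Vec d) :
    frozenDensity d b σ θ t y s x t y =
      (Real.sqrt ((2 * Real.pi) ^ d * (freezeCov d σ θ t y s t).det))⁻¹ *
        Real.exp (-(1 / 2) * inner ℝ (toEuclideanCLM (𝕜 := ℝ) (freezeCov d σ θ t y s t)⁻¹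
          (x - θ s t y)) (x - θ s t y)) := by
  rw [frozenDensity, hθ.freezeMean_add_sub hs ht, real_inner_comm, inner_toEuclideanCLM,
    dotProduct_comm]

/-- Under (H^σ_α) and (H^b_β), with `b, σ` smooth in space with bounded
derivatives of every order, for any `T > 0` and `j ≥ 0` there are constants depending only
on `Θ = (T,α,β,κ₀,κ₁,d)` such that, for `(s,t) ∈ 𝔻^T_0`:
(a) `p̃₁(s,x,t,y) ≥ C̃₀ 𝐠_{λ̃₀⁻¹}(s,x,t,y)`, and
(b) `|x − θ_{s,t}(y)|^γ |∇_x^j p̃₁(s,x,t,y)| ≤ C̃_j (t−s)^{(γ−j)/2} 𝐠_{λ̃_j}(s,x,t,y)` for all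
`γ ∈ [0,1]`. Here `𝐠_λ(s,x,t,y) = g_λ(t−s, θ^{(1)}_{t,s}(x) − y)`. -/
theorem frozenDensity_flow_bounds
    (d : ℕ) (T α β κ₀ κ₁ : ℝ) (hT : 0 < T) (hα : α ∈ Set.Ioc (0 : ℝ) 1)
    (hβ : β ∈ Set.Icc (0 : ℝ) 1) (hκ₀ : 1 ≤ κ₀) (hκ₁ : 0 < κ₁)
    (ρ : Vec d → ℝ) (hρ : IsMollifier d ρ) (j : ℕ) :
    ∃ C₀ > (0 : ℝ), ∃ l₀ > (0 : ℝ), ∃ Cj > (0 : ℝ), ∃ lj > (0 : ℝ),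
      ∀ (b : ℝ → Vec d → Vec d) (σ : ℝ → Vec d → Matrix (Fin d) (Fin d) ℝ)
        (θ θ1 : ℝ → ℝ → Vec d → Vec d),
        EllipticHolder d σ κ₀ α → HolderDrift d b κ₁ β →
        SmoothVecBounded d b → SmoothMatBounded d σ →
        IsFlow d b θ → IsFlow d (mollifiedDrift d ρ 1 b) θ1 →
      ∀ s t : ℝ, 0 ≤ s → s < t → t - s < T → ∀ x y : Vec d,
        (C₀ * gaussk d l₀⁻¹ (t - s) (θ1 t s x - y) ≤ frozenDensity d b σ θ t y s x t y) ∧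
        ∀ γ ∈ Set.Icc (0 : ℝ) 1,
          ‖x - θ s t y‖ ^ γ *
              ‖iteratedFDeriv ℝ j (fun x' => frozenDensity d b σ θ t y s x' t y) x‖ ≤
            Cj * (t - s) ^ ((γ - (j : ℝ)) / 2) * gaussk d lj (t - s) (θ1 t s x - y) := by
  have hκ : 0 < κ₀ := by linarith
  have hπ := Real.pi_pos
  set e := Real.exp (κ₁ * T) with he
  have he0 : 0 < e := Real.exp_pos _
  set R := 8 * e ^ 2 * κ₁ ^ 2 * T with hR
  refine ⟨(Real.sqrt ((2 * Real.pi * κ₀) ^ d))⁻¹ * Real.exp (-(κ₀ / 2 * R)), by positivity,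
    (κ₀ * e ^ 2)⁻¹, by positivity,
    (Real.sqrt ((2 * Real.pi * κ₀⁻¹) ^ d))⁻¹ *
      (j.factorial * κ₀ ^ j * Real.exp (κ₀ * (j + 1 : ℕ) ^ 2)) *
      Real.exp (R / (8 * κ₀ * e ^ 2)), by positivity, (8 * κ₀ * e ^ 2)⁻¹, by positivity, ?_⟩
  intro b σ θ θ1 hσ hb hbs _ hθ hθ1 s t hs hst hT' x y
  have ht : 0 ≤ t := hs.trans hst.le
  set τ := t - s with hτ
  have hτ0 : 0 < τ := sub_pos.2 hst
  have hcont : ContinuousOn (fun r => θ r t y) (Icc s t) := by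
    have h1 := intervalIntegral.continuousOn_primitive_interval'
      (hθ.intervalIntegrable_backward hb hβ hκ₁.le hs hst.le y) right_mem_uIcc
    rw [uIcc_of_le hst.le] at h1
    exact (continuousOn_const.add h1).congr fun r hr => hθ t r ht (hs.trans hr.1) y
  obtain ⟨hC, hCq⟩ := hσ.freezeCov_bounds hs hst.le hcont
  obtain ⟨hlen1, hlen2⟩ := IsFlow.norm_sub_comparison hρ hb hβ hκ₁.le
    (fun t => (hbs.1 t).continuous) hθ hθ1 hs hst.le x y
  have hsq1 := sq_div_le_of_two_add_le (norm_nonneg _) (norm_nonneg _) hκ₁.le hτ0 hT'.le hlen1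
  have hsq2 := sq_div_le_of_two_add_le (norm_nonneg _) (norm_nonneg _) hκ₁.le hτ0 hT'.le hlen2
  obtain ⟨hN1, hN2⟩ := hC.normalization_bounds hκ hτ0 hCq
  have hden : (fun x' => frozenDensity d b σ θ t y s x' t y) = _ :=
    funext fun x' => hθ.frozenDensity_eq σ hs ht x' y
  set m := θ s t y with hm
  set N := (Real.sqrt ((2 * Real.pi) ^ d * (freezeCov d σ θ t y s t).det))⁻¹ with hN
  have hN0 : 0 ≤ N := by positivity
  set p := ‖θ1 t s x - y‖ with hp
  have hτd : 0 ≤ τ ^ (-(d : ℝ) / 2) := by positivity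
  refine ⟨?_, fun γ hγ => ?_⟩
  · rw [hθ.frozenDensity_eq σ hs ht x y, gaussk]
    have hq := ((hC.inv_bounds (by positivity) (by positivity) hCq).2 (x - m)).2
    calc _ = (Real.sqrt ((2 * Real.pi * κ₀) ^ d))⁻¹ * τ ^ (-(d : ℝ) / 2) *
          (Real.exp (-(κ₀ / 2 * R)) * Real.exp (-(κ₀ * e ^ 2)⁻¹⁻¹ * p ^ 2 / τ)) := by ring
      _ ≤ _ := by
        rw [← Real.exp_add]
        refine mul_le_mul hN1 (Real.exp_le_exp.2 ?_) (Real.exp_pos _).le hN0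
        have h1 : (κ₀⁻¹ * τ)⁻¹ * ‖x - m‖ ^ 2 = κ₀ * (‖x - m‖ ^ 2 / τ) := by field_simp
        have h2 : -(κ₀ * e ^ 2)⁻¹⁻¹ * p ^ 2 / τ = -(κ₀ / 2 * (2 * e ^ 2 * (p ^ 2 / τ))) := by
          rw [inv_inv]; ring
        have h3 := mul_le_mul_of_nonneg_left hsq2 (by positivity : 0 ≤ κ₀ / 2)
        rw [h1] at hq
        rw [h2]
        linarith
  · have hsmooth : ContDiff ℝ j fun x' : Vec d => Real.exp (-(1 / 2) * inner ℝ
        (toEuclideanCLM (𝕜 := ℝ) (freezeCov d σ θ t y s t)⁻¹ (x' - m)) (x' - m)) := by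
      have h1 : ContDiff ℝ j fun z : Vec d => z - m := contDiff_id.sub contDiff_const
      exact (contDiff_const.mul (((ContinuousLinearMap.contDiff _).comp h1).inner ℝ h1)).exp
    rw [hden]
    have hder := iteratedFDeriv_const_smul_apply' (a := N) (x := x) hsmooth.contDiffAt
    simp only [smul_eq_mul] at hder
    rw [hder, norm_smul, Real.norm_of_nonneg hN0, mul_left_comm, gaussk]
    have hw := hC.weighted_iteratedFDeriv_gaussian_le hκ₀ hτ0 hCq m x j hγ
    have hexp : Real.exp (-(‖x - m‖ ^ 2 / τ / (4 * κ₀))) ≤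
        Real.exp (R / (8 * κ₀ * e ^ 2)) * Real.exp (-(8 * κ₀ * e ^ 2)⁻¹ * p ^ 2 / τ) := by
      rw [← Real.exp_add, Real.exp_le_exp]
      have h1 := div_le_div_of_nonneg_right hsq1 (by positivity : 0 ≤ 8 * κ₀ * e ^ 2)
      have h2 : -(8 * κ₀ * e ^ 2)⁻¹ * p ^ 2 / τ = -(p ^ 2 / τ / (8 * κ₀ * e ^ 2)) := by
        rw [div_eq_mul_inv _ (8 * κ₀ * e ^ 2)]; ring
      have h3 : (2 * e ^ 2 * (‖x - m‖ ^ 2 / τ) + R) / (8 * κ₀ * e ^ 2) =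
          ‖x - m‖ ^ 2 / τ / (4 * κ₀) + R / (8 * κ₀ * e ^ 2) := by
        field_simp
        ring
      rw [h2]
      linarith
    calc _ ≤ (Real.sqrt ((2 * Real.pi * κ₀⁻¹) ^ d))⁻¹ * τ ^ (-(d : ℝ) / 2) *
          (j.factorial * κ₀ ^ j * Real.exp (κ₀ * (j + 1 : ℕ) ^ 2) * τ ^ ((γ - j) / 2) *
            (Real.exp (R / (8 * κ₀ * e ^ 2)) *
              Real.exp (-(8 * κ₀ * e ^ 2)⁻¹ * p ^ 2 / τ))) := by
          refine mul_le_mul hN2 (hw.trans ?_) (by positivity) (by positivity)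
          gcongr
      _ = _ := by ring
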